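/- If a is an odd natural number, b and c are even natural numbers, and a < c, then Player 1 has a winning strategy in the (a,b,c)-game; that is, the state with a ones, b twos, and c threes is a first-player win in the reversed Zeckendorf game. -/

import Mathlib

/-- The Fibonacci numbers indexed so that `zfib 1 = 1`, `zfib 2 = 2`,
and `zfib (i+1) = zfib i + zfib (i-1)`. -/
def zfib (i : ℕ) : ℕ := Nat.fib (i + 1)

/-- A game state: a finitely supported function recording the height of each bin.
Bin indices start at `1`; index `0` is unused. -/
abbrev ZState := ℕ →₀ ℕ

/-- The legal moves of the reversed Zeckendorf game. -/
inductive ZMove : ZState → ZState → Prop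
  | split (h : ZState) (i : ℕ) (hi : 2 ≤ i) (hpos : 0 < h (i + 1)) :
      ZMove h (h - Finsupp.single (i + 1) 1 + Finsupp.single i 1 + Finsupp.single (i - 1) 1)
  | splitTwo (h : ZState) (hpos : 0 < h 2) :
      ZMove h (h - Finsupp.single 2 1 + Finsupp.single 1 2)
  | combine (h : ZState) (i : ℕ) (hi : 2 < i) (h1 : 0 < h (i + 1)) (h2 : 0 < h (i - 2)) :
      ZMove h (h - Finsupp.single (i + 1) 1 - Finsupp.single (i - 2) 1 + Finsupp.single i 2)
  | combineTwo (h : ZState) (h1 : 0 < h 3) (h2 : 0 < h 1) :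
      ZMove h (h - Finsupp.single 3 1 - Finsupp.single 1 1 + Finsupp.single 2 2)

mutual
  /-- The state is a first-player win: some legal move leads to a state that is a
  loss for the player then to move. -/
  inductive ZFirstWin : ZState → Prop
    | intro (h h' : ZState) (m : ZMove h h') (hl : ZLoss h') : ZFirstWin h
  /-- The state is a loss for the player to move (i.e., not a first-player win):
  every legal move leads to a first-player win for the opponent. -/
  inductive ZLoss : ZState → Prop
    | intro (h : ZState) (hall : ∀ h', ZMove h h' → ZFirstWin h') : ZLoss h
end

/-- The starting state of the `(a,b,c)`-game: `a` ones, `b` twos and `c` threes. -/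
noncomputable def abcState (a b c : ℕ) : ZState :=
  Finsupp.single 1 a + Finsupp.single 2 b + Finsupp.single 3 c

theorem abcState_apply (a b c j : ℕ) : abcState a b c j =
    (if j = 1 then a else 0) + (if j = 2 then b else 0) + (if j = 3 then c else 0) := by
  simp [abcState, Finsupp.single_apply, eq_comm]

theorem eqA (a b c : ℕ) : abcState a b (c+1) - Finsupp.single (2 + 1) 1 + Finsupp.single 2 1
    + Finsupp.single (2 - 1) 1 = abcState (a+1) (b+1) c := by
  ext j
  simp only [Finsupp.add_apply, Finsupp.tsub_apply, abcState_apply, Finsupp.single_apply]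
  split_ifs <;> omega

theorem eqB (a b c : ℕ) : abcState a (b+1) c - Finsupp.single 2 1 + Finsupp.single 1 2
    = abcState (a+2) b c := by
  ext j
  simp only [Finsupp.add_apply, Finsupp.tsub_apply, abcState_apply, Finsupp.single_apply]
  split_ifs <;> omega

theorem eqC (a b c : ℕ) : abcState (a+1) b (c+1) - Finsupp.single 3 1 - Finsupp.single 1 1
    + Finsupp.single 2 2 = abcState a (b+2) c := by
  ext j
  simp only [Finsupp.add_apply, Finsupp.tsub_apply, abcState_apply, Finsupp.single_apply]
  split_ifs <;> omega

theorem moveA (a b c : ℕ) : ZMove (abcState a b (c+1)) (abcState (a+1) (b+1) c) := by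
  rw [← eqA]
  exact ZMove.split _ 2 le_rfl (by simp [abcState_apply])

theorem moveB (a b c : ℕ) : ZMove (abcState a (b+1) c) (abcState (a+2) b c) := by
  rw [← eqB]
  exact ZMove.splitTwo _ (by simp [abcState_apply])

theorem moveC (a b c : ℕ) : ZMove (abcState (a+1) b (c+1)) (abcState a (b+2) c) := by
  rw [← eqC]
  exact ZMove.combineTwo _ (by simp [abcState_apply]) (by simp [abcState_apply])

theorem move_inv (a b c : ℕ) (h' : ZState) (m : ZMove (abcState a b c) h') :
    (∃ c', c = c' + 1 ∧ h' = abcState (a+1) (b+1) c') ∨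
    (∃ b', b = b' + 1 ∧ h' = abcState (a+2) b' c) ∨
    (∃ a' c', a = a' + 1 ∧ c = c' + 1 ∧ h' = abcState a' (b+2) c') := by
  cases m with
  | split i hi hpos =>
    left
    rw [abcState_apply] at hpos
    have h2 : i = 2 := by
      by_contra hne
      split_ifs at hpos <;> omega
    subst h2
    obtain ⟨c', rfl⟩ : ∃ c', c = c' + 1 := ⟨c - 1, by simp at hpos; omega⟩
    exact ⟨c', rfl, eqA _ _ _⟩
  | splitTwo hpos =>
    right; left
    rw [abcState_apply] at hpos
    obtain ⟨b', rfl⟩ : ∃ b', b = b' + 1 := ⟨b - 1, by simp at hpos; omega⟩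
    exact ⟨b', rfl, eqB _ _ _⟩
  | combine i hi h1 h2 =>
    exfalso
    rw [abcState_apply] at h1
    split_ifs at h1 <;> omega
  | combineTwo h1 h2 =>
    right; right
    rw [abcState_apply] at h1 h2
    obtain ⟨c', rfl⟩ : ∃ c', c = c' + 1 := ⟨c - 1, by simp at h1; omega⟩
    obtain ⟨a', rfl⟩ : ∃ a', a = a' + 1 := ⟨a - 1, by simp at h2; omega⟩
    exact ⟨a', c', rfl, rfl, eqC _ _ _⟩

/-- The losing triples. -/
def LosePos (a b c : ℕ) : Prop :=
  b % 2 = 0 ∧ ((a < c ∧ a % 2 = 0) ∨ (c ≤ a ∧ c % 2 = 0))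

theorem main_aux (n : ℕ) : ∀ a b c : ℕ, 3 * c + b = n →
    (LosePos a b c → ZLoss (abcState a b c)) ∧
    (¬ LosePos a b c → ZFirstWin (abcState a b c)) := by
  induction n using Nat.strong_induction_on with
  | _ n ih =>
    intro a b c hn
    constructor
    · intro hl
      refine ZLoss.intro _ fun h' m => ?_
      rcases move_inv a b c h' m with ⟨c', rfl, rfl⟩ | ⟨b', rfl, rfl⟩ | ⟨a', c', rfl, rfl, rfl⟩
      · exact (ih _ (by omega) _ _ _ rfl).2 (by unfold LosePos at *; omega)
      · exact (ih _ (by omega) _ _ _ rfl).2 (by unfold LosePos at *; omega)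
      · exact (ih _ (by omega) _ _ _ rfl).2 (by unfold LosePos at *; omega)
    · intro hl
      have key : (∃ c', c = c' + 1 ∧ LosePos (a+1) (b+1) c') ∨
          (∃ b', b = b' + 1 ∧ LosePos (a+2) b' c) ∨
          (∃ a' c', a = a' + 1 ∧ c = c' + 1 ∧ LosePos a' (b+2) c') := by
        by_cases hA : 1 ≤ c ∧ LosePos (a+1) (b+1) (c-1)
        · exact Or.inl ⟨c - 1, by omega, hA.2⟩
        by_cases hB : 1 ≤ b ∧ LosePos (a+2) (b-1) c
        · exact Or.inr (Or.inl ⟨b - 1, by omega, hB.2⟩)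
        refine Or.inr (Or.inr ⟨a - 1, c - 1, ?_, ?_, ?_⟩) <;> unfold LosePos at * <;> omega
      rcases key with ⟨c', rfl, h⟩ | ⟨b', rfl, h⟩ | ⟨a', c', rfl, rfl, h⟩
      · exact ZFirstWin.intro _ _ (moveA _ _ _) ((ih _ (by omega) _ _ _ rfl).1 h)
      · exact ZFirstWin.intro _ _ (moveB _ _ _) ((ih _ (by omega) _ _ _ rfl).1 h)
      · exact ZFirstWin.intro _ _ (moveC _ _ _) ((ih _ (by omega) _ _ _ rfl).1 h)

theorem abcGame_odd_even_even_lt_firstPlayerWin (a b c : ℕ) (ha : Odd a) (hb : Even b) (hc : Even c) (hac : a < c) :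
    ZFirstWin (abcState a b c) := by
  refine (main_aux _ a b c rfl).2 ?_
  rw [Nat.odd_iff] at ha
  unfold LosePos
  omega
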